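/- Let ν_n^b be the sampling measure of the conditional mixture algorithm with mixing probabilities p_i = (n−i)/(n−i+1), q_i = 1−p_i, and level parameter a = a_b ∈ (0,1) depending on b in such a way that 1−a_b is of exact order b^{−1/(2(n−1))+δ} for some 0 < δ < 1/(2(n−1)) (i.e. (1−a_b)/b^{−1/(2(n−1))+δ} stays bounded away from 0 and ∞ as b → ∞). Then the conditional mixture algorithm has asymptotically optimal relative error for computing p_b = P(S_n > b): lim_{b→∞} E p̂_b² / p_b² = 1. -/

import Mathlib

open MeasureTheory Filter Set Real

/-- The tail of a density that is regularly varying with index `-α - 1` is regularly varying with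
index `-α`. -/
theorem tendsto_tail_ratio {f : ℝ → ℝ} {α : ℝ} (hf_nonneg : ∀ x, 0 ≤ f x) (hf : Integrable f)
    (hf_rv : ∀ x : ℝ, 0 < x →
      Tendsto (fun u => f (u * x) / f u) atTop (nhds (x ^ (-α - 1))))
    {G : ℝ → ℝ} (hG : ∀ b, G b = ∫ t in Ioi b, f t) (hG_pos : ∀ b, 0 < G b)
    {x : ℝ} (hx : 0 < x) :
    Tendsto (fun u => G (x * u) / G u) atTop (nhds (x ^ (-α))) := by
  have hne : ∀ᶠ u in atTop, 0 < f u := by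
    have h1 := hf_rv 1 one_pos
    rw [one_rpow] at h1
    filter_upwards [h1.eventually (lt_mem_nhds (show (0 : ℝ) < 1 by norm_num))] with u hu
    refine lt_of_le_of_ne (hf_nonneg u) fun h => ?_
    rw [← h, div_zero] at hu
    exact lt_irrefl _ hu
  set c := x ^ (-α - 1) with hc
  have hcx : x ^ (-α) = x * c := by
    rw [hc, rpow_sub_one hx.ne']; field_simp
  have hchange : ∀ u, G (x * u) = x * ∫ t in Ioi u, f (x * t) := by
    intro u
    rw [hG, ← integral_comp_mul_left_Ioi' f u hx, smul_eq_mul]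
  have hint : ∀ u, IntegrableOn (fun t => f (x * t)) (Ioi u) :=
    fun u => (hf.comp_mul_left' hx.ne').integrableOn
  rw [Metric.tendsto_nhds]
  intro ε hε
  have hε' : 0 < ε / (2 * x) := by positivity
  have hev := (Metric.tendsto_nhds.1 (hf_rv x hx)) _ hε'
  obtain ⟨u₀, hu₀⟩ := eventually_atTop.1 (hev.and hne)
  filter_upwards [eventually_ge_atTop u₀] with u hu
  have hb : ∀ t ∈ Ioi u, (c - ε / (2 * x)) * f t ≤ f (x * t) ∧
      f (x * t) ≤ (c + ε / (2 * x)) * f t := by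
    intro t ht
    obtain ⟨h1, h2⟩ := hu₀ t (hu.trans (le_of_lt ht))
    rw [Real.dist_eq, abs_lt] at h1
    rw [mul_comm x t]
    constructor
    · rw [← le_div_iff₀ h2]; linarith
    · rw [← div_le_iff₀ h2]; linarith
  have hlo : (c - ε / (2 * x)) * G u ≤ ∫ t in Ioi u, f (x * t) := by
    rw [hG, ← integral_const_mul]
    exact setIntegral_mono_on (hf.integrableOn.const_mul _) (hint u) measurableSet_Ioi
      fun t ht => (hb t ht).1
  have hhi : ∫ t in Ioi u, f (x * t) ≤ (c + ε / (2 * x)) * G u := by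
    rw [hG, ← integral_const_mul]
    exact setIntegral_mono_on (hint u) (hf.integrableOn.const_mul _) measurableSet_Ioi
      fun t ht => (hb t ht).2
  rw [hchange, hcx, mul_div_assoc, Real.dist_eq, ← mul_sub, abs_mul, abs_of_pos hx]
  have hle : |(∫ t in Ioi u, f (x * t)) / G u - c| ≤ ε / (2 * x) := by
    rw [abs_le]
    constructor
    · have := (le_div_iff₀ (hG_pos u)).2 hlo; linarith
    · have := (div_le_iff₀ (hG_pos u)).2 hhi; linarith
  calc x * _ ≤ x * (ε / (2 * x)) := by gcongr
    _ = ε / 2 := by field_simp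
    _ < ε := by linarith

/-- A nonincreasing function with `G (2 t) ≤ 2 ^ (-c) G t` for large `t` decays at least like
`t ^ (-c)`. -/
theorem exists_le_rpow_of_doubling {G : ℝ → ℝ} (hG : Antitone G) (hG_pos : ∀ t, 0 < G t)
    {c : ℝ} (hc : 0 ≤ c) (h : ∀ᶠ t in atTop, G (2 * t) ≤ 2 ^ (-c) * G t) :
    ∃ K > 0, ∀ᶠ t in atTop, G t ≤ K * t ^ (-c) := by
  obtain ⟨T, hT⟩ := h.exists_forall_of_atTop
  obtain ⟨T, hT0, hT⟩ : ∃ T > 0, ∀ t ≥ T, G (2 * t) ≤ 2 ^ (-c) * G t :=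
    ⟨max T 1, by positivity, fun t ht => hT t ((le_max_left _ _).trans ht)⟩
  have hpow : ∀ k : ℕ, G (2 ^ k * T) ≤ ((2 : ℝ) ^ k) ^ (-c) * G T := by
    intro k
    induction k with
    | zero => simp
    | succ k ih =>
      have h2 : T ≤ 2 ^ k * T := le_mul_of_one_le_left hT0.le (one_le_pow₀ (by norm_num))
      calc G (2 ^ (k + 1) * T) = G (2 * (2 ^ k * T)) := by ring_nf
        _ ≤ 2 ^ (-c) * G (2 ^ k * T) := hT _ h2
        _ ≤ 2 ^ (-c) * (((2 : ℝ) ^ k) ^ (-c) * G T) := by gcongr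
        _ = _ := by rw [pow_succ, mul_rpow (by positivity) (by positivity)]; ring
  refine ⟨2 ^ c * T ^ c * G T, by have := hG_pos T; positivity, ?_⟩
  filter_upwards [eventually_ge_atTop T] with t ht
  have ht0 : 0 < t := hT0.trans_le ht
  obtain ⟨k, hk1, hk2⟩ := exists_nat_pow_near ((one_le_div hT0).2 ht) (one_lt_two (α := ℝ))
  have hGT := hG_pos T
  calc G t ≤ G (2 ^ k * T) := hG ((le_div_iff₀ hT0).1 hk1)
    _ ≤ ((2 : ℝ) ^ k) ^ (-c) * G T := hpow k
    _ ≤ (t / T / 2) ^ (-c) * G T := by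
        gcongr ?_ * _
        refine rpow_le_rpow_of_nonpos (by positivity) ?_ (by linarith)
        rw [pow_succ] at hk2
        linarith
    _ = _ := by
        rw [div_rpow (by positivity) (by positivity), div_rpow (by positivity) (by positivity),
          rpow_neg hT0.le, rpow_neg (zero_le_two (α := ℝ))]
        field_simp

/-- A nonincreasing function with `2 ^ (-d) G t ≤ G (2 t)` for large `t` decays at most like
`t ^ (-d)`. -/
theorem exists_rpow_le_of_doubling {G : ℝ → ℝ} (hG : Antitone G) (hG_pos : ∀ t, 0 < G t)
    {d : ℝ} (hd : 0 ≤ d) (h : ∀ᶠ t in atTop, 2 ^ (-d) * G t ≤ G (2 * t)) :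
    ∃ K > 0, ∀ᶠ t in atTop, K * t ^ (-d) ≤ G t := by
  obtain ⟨T, hT⟩ := h.exists_forall_of_atTop
  obtain ⟨T, hT0, hT⟩ : ∃ T > 0, ∀ t ≥ T, 2 ^ (-d) * G t ≤ G (2 * t) :=
    ⟨max T 1, by positivity, fun t ht => hT t ((le_max_left _ _).trans ht)⟩
  have hpow : ∀ k : ℕ, ((2 : ℝ) ^ k) ^ (-d) * G T ≤ G (2 ^ k * T) := by
    intro k
    induction k with
    | zero => simp
    | succ k ih =>
      have h2 : T ≤ 2 ^ k * T := le_mul_of_one_le_left hT0.le (one_le_pow₀ (by norm_num))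
      calc _ = 2 ^ (-d) * (((2 : ℝ) ^ k) ^ (-d) * G T) := by
            rw [pow_succ, mul_rpow (by positivity) (by positivity)]; ring
        _ ≤ 2 ^ (-d) * G (2 ^ k * T) := by gcongr
        _ ≤ G (2 * (2 ^ k * T)) := hT _ h2
        _ = G (2 ^ (k + 1) * T) := by ring_nf
  have hGT := hG_pos T
  refine ⟨2 ^ (-d) * T ^ d * G T, by positivity, ?_⟩
  filter_upwards [eventually_ge_atTop T] with t ht
  have ht0 : 0 < t := hT0.trans_le ht
  obtain ⟨k, hk1, hk2⟩ := exists_nat_pow_near ((one_le_div hT0).2 ht) (one_lt_two (α := ℝ))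
  calc _ = (2 * (t / T)) ^ (-d) * G T := by
        rw [mul_rpow (by positivity) (by positivity), div_rpow (by positivity) (by positivity),
          rpow_neg hT0.le]
        field_simp
    _ ≤ ((2 : ℝ) ^ (k + 1)) ^ (-d) * G T := by
        gcongr ?_ * _
        refine rpow_le_rpow_of_nonpos (by positivity) ?_ (by linarith)
        rw [pow_succ]
        linarith
    _ ≤ G (2 ^ (k + 1) * T) := hpow _
    _ ≤ G t := hG ((div_lt_iff₀ hT0).1 hk2).le

theorem tendsto_zero_of_regularlyVarying {G : ℝ → ℝ} (hG : Antitone G) (hG_pos : ∀ t, 0 < G t)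
    {α : ℝ} (hα : 0 < α) (h : Tendsto (fun t => G (2 * t) / G t) atTop (nhds (2 ^ (-α)))) :
    Tendsto G atTop (nhds 0) := by
  have h2 : (2 : ℝ) ^ (-α) < 2 ^ (-(α / 2)) :=
    rpow_lt_rpow_of_exponent_lt one_lt_two (by linarith)
  obtain ⟨K, -, hK⟩ := exists_le_rpow_of_doubling hG hG_pos (half_pos hα).le <| by
    filter_upwards [h.eventually (gt_mem_nhds h2)] with t ht
    exact ((div_lt_iff₀ (hG_pos t)).1 ht).le
  refine squeeze_zero' (Eventually.of_forall fun t => (hG_pos t).le) hK ?_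
  simpa using (tendsto_rpow_neg_atTop (half_pos hα)).const_mul K

/-- If `G` is nonincreasing and regularly varying with index `-α < 0`, then `G (t ^ θ) ^ 2` is
negligible with respect to `G t` for every `θ > 1 / 2`. -/
theorem tendsto_sq_rpow_div_of_regularlyVarying {G : ℝ → ℝ} (hG : Antitone G)
    (hG_pos : ∀ t, 0 < G t) {α : ℝ} (hα : 0 < α)
    (h : Tendsto (fun t => G (2 * t) / G t) atTop (nhds (2 ^ (-α)))) {θ : ℝ} (hθ : 1 / 2 < θ) :
    Tendsto (fun t => G (t ^ θ) ^ 2 / G t) atTop (nhds 0) := by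
  obtain ⟨ε, hε0, hεα, hε⟩ : ∃ ε, 0 < ε ∧ ε < α ∧ 0 < 2 * θ * (α - ε) - (α + ε) := by
    have hcont : Tendsto (fun ε : ℝ => 2 * θ * (α - ε) - (α + ε)) (nhdsWithin 0 (Ioi 0))
        (nhds (2 * θ * (α - 0) - (α + 0))) :=
      (Continuous.tendsto (by fun_prop) 0).mono_left nhdsWithin_le_nhds
    have hpos : 0 < 2 * θ * (α - 0) - (α + 0) := by nlinarith
    have hlt : ∀ᶠ ε : ℝ in nhdsWithin 0 (Ioi 0), ε < α :=
      nhdsWithin_le_nhds (gt_mem_nhds hα)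
    obtain ⟨ε, h1, h2, h3⟩ :=
      (hlt.and ((hcont.eventually (lt_mem_nhds hpos)).and self_mem_nhdsWithin)).exists
    exact ⟨ε, h3, h1, h2⟩
  have h1 : (2 : ℝ) ^ (-α) < 2 ^ (-(α - ε)) :=
    rpow_lt_rpow_of_exponent_lt one_lt_two (by linarith)
  have h2 : (2 : ℝ) ^ (-(α + ε)) < 2 ^ (-α) :=
    rpow_lt_rpow_of_exponent_lt one_lt_two (by linarith)
  obtain ⟨K, hK0, hK⟩ := exists_le_rpow_of_doubling hG hG_pos (sub_pos.2 hεα).le <| by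
    filter_upwards [h.eventually (gt_mem_nhds h1)] with t ht
    exact ((div_lt_iff₀ (hG_pos t)).1 ht).le
  obtain ⟨L, hL0, hL⟩ := exists_rpow_le_of_doubling hG hG_pos (add_pos hα hε0).le <| by
    filter_upwards [h.eventually (lt_mem_nhds h2)] with t ht
    exact ((lt_div_iff₀ (hG_pos t)).1 ht).le
  have hθ0 : 0 < θ := by linarith
  have hlim : Tendsto (fun t : ℝ => K ^ 2 / L * t ^ (-(2 * θ * (α - ε) - (α + ε)))) atTop
      (nhds 0) := by
    simpa using (tendsto_rpow_neg_atTop hε).const_mul (K ^ 2 / L)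
  refine squeeze_zero' (Eventually.of_forall fun t => ?_) ?_ hlim
  · have := hG_pos t; positivity
  filter_upwards [(tendsto_rpow_atTop hθ0).eventually hK, hL, eventually_gt_atTop 0]
    with t htK htL ht
  calc G (t ^ θ) ^ 2 / G t ≤ (K * (t ^ θ) ^ (-(α - ε))) ^ 2 / (L * t ^ (-(α + ε))) := by
        have := hG_pos (t ^ θ)
        gcongr
    _ = _ := by
        rw [mul_pow, ← rpow_mul ht.le, ← rpow_natCast (t ^ _) 2, ← rpow_mul ht.le,
          mul_div_mul_comm, ← rpow_sub ht]
        congr 2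
        push_cast
        ring

/-- Iterated integral of `∏ H · φ` along the random walk with step distribution `μ`, with `t` the
remaining distance to the target level and the first argument the number of remaining steps. -/
noncomputable def walkIntegral (μ : Measure ℝ) (H : ℕ → ℝ → ℝ → ℝ) (φ : ℝ → ℝ) : ℕ → ℝ → ℝ
  | 0, t => φ t
  | m + 1, t => ∫ x, H m t x * walkIntegral μ H φ m (t - x) ∂μ

section walkIntegral

variable {μ : Measure ℝ} {H : ℕ → ℝ → ℝ → ℝ} {φ : ℝ → ℝ}

theorem measurable_walkIntegral [SFinite μ] (hH : ∀ m, Measurable (Function.uncurry (H m)))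
    (hφ : Measurable φ) (m : ℕ) : Measurable (walkIntegral μ H φ m) := by
  induction m with
  | zero => exact hφ
  | succ m ih =>
    refine (StronglyMeasurable.integral_prod_right (f := fun t x =>
      H m t x * walkIntegral μ H φ m (t - x)) ?_).measurable
    exact ((hH m).mul (ih.comp (measurable_fst.sub measurable_snd))).stronglyMeasurable

theorem walkIntegral_nonneg (hH0 : ∀ m t x, 0 ≤ H m t x) (hφ0 : ∀ t, 0 ≤ φ t) (m : ℕ) (t : ℝ) :
    0 ≤ walkIntegral μ H φ m t := by
  induction m generalizing t with
  | zero => exact hφ0 t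
  | succ m ih => exact integral_nonneg fun x => mul_nonneg (hH0 m t x) (ih _)

theorem walkIntegral_le_pow [IsProbabilityMeasure μ] (hH0 : ∀ m t x, 0 ≤ H m t x)
    (hφ0 : ∀ t, 0 ≤ φ t) {C : ℝ} (hC : 0 ≤ C) (hHC : ∀ m t x, H m t x ≤ C) (hφ1 : ∀ t, φ t ≤ 1)
    (m : ℕ) (t : ℝ) : walkIntegral μ H φ m t ≤ C ^ m := by
  induction m generalizing t with
  | zero => simpa [walkIntegral] using hφ1 t
  | succ m ih =>
    have : walkIntegral μ H φ (m + 1) t ≤ ∫ _, C ^ (m + 1) ∂μ := by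
      refine integral_mono_of_nonneg (Eventually.of_forall fun x => ?_) (integrable_const _)
        (Eventually.of_forall fun x => ?_)
      · exact mul_nonneg (hH0 m t x) (walkIntegral_nonneg hH0 hφ0 _ _)
      · dsimp only
        rw [pow_succ']
        exact mul_le_mul (hHC m t x) (ih _) (walkIntegral_nonneg hH0 hφ0 _ _) hC
    simpa using this

theorem integrable_mul_walkIntegral [IsProbabilityMeasure μ]
    (hH : ∀ m, Measurable (Function.uncurry (H m))) (hφ : Measurable φ)
    (hH0 : ∀ m t x, 0 ≤ H m t x) (hφ0 : ∀ t, 0 ≤ φ t) {C : ℝ} (hC : 0 ≤ C)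
    (hHC : ∀ m t x, H m t x ≤ C) (hφ1 : ∀ t, φ t ≤ 1) (m : ℕ) (t : ℝ) :
    Integrable (fun x => H m t x * walkIntegral μ H φ m (t - x)) μ := by
  refine Integrable.of_bound (C := C ^ (m + 1)) (Measurable.aestronglyMeasurable ?_) <|
    Eventually.of_forall fun x => ?_
  · exact ((hH m).comp (by fun_prop : Measurable fun x : ℝ => (t, x))).mul
      ((measurable_walkIntegral hH hφ m).comp (by fun_prop))
  · have h0 := walkIntegral_nonneg (μ := μ) hH0 hφ0 m (t - x)
    rw [Real.norm_of_nonneg (mul_nonneg (hH0 m t x) h0), pow_succ']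
    exact mul_le_mul (hHC m t x) (walkIntegral_le_pow hH0 hφ0 hC hHC hφ1 _ _) h0 hC

end walkIntegral

/-- Fubini's theorem for the random walk whose steps have density `f`. -/
theorem integral_eq_walkIntegral {f : ℝ → ℝ} (hf_nonneg : ∀ x, 0 ≤ f x) (hf : Integrable f)
    {H : ℕ → ℝ → ℝ → ℝ} {φ : ℝ → ℝ} (hH : ∀ m, Measurable (Function.uncurry (H m)))
    (hφ : Measurable φ) (hH0 : ∀ m t x, 0 ≤ H m t x) (hφ0 : ∀ t, 0 ≤ φ t) {C : ℝ}
    (hHC : ∀ m t x, H m t x ≤ C) (hφ1 : ∀ t, φ t ≤ 1) (n : ℕ) (t : ℝ) :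
    ∫ x : Fin n → ℝ,
      (∏ i, f (x i) * H (Fin.rev i) (t - ∑ j : Fin _, if (j : ℕ) < i then x j else 0) (x i)) *
        φ (t - ∑ j, x j) =
      walkIntegral (volume.withDensity fun x => ENNReal.ofReal (f x)) H φ n t := by
  induction n generalizing t with
  | zero => simp [walkIntegral, integral_unique, Measure.real, volume_pi]
  | succ n ih =>
    have hint : Integrable (fun x : Fin (n + 1) → ℝ =>
        (∏ i, f (x i) * H (Fin.rev i) (t - ∑ j : Fin _, if (j : ℕ) < i then x j else 0) (x i)) *
        φ (t - ∑ j, x j)) := by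
      have h1 : Integrable (fun x : Fin (n + 1) → ℝ => ∏ i, f (x i)) :=
        Integrable.fintype_prod fun _ => hf
      refine (h1.mul_bdd (c := C ^ (n + 1)) (g := fun x : Fin (n + 1) → ℝ =>
        (∏ i, H (Fin.rev i) (t - ∑ j : Fin _, if (j : ℕ) < i then x j else 0) (x i)) *
        φ (t - ∑ j, x j)) (Measurable.aestronglyMeasurable ?_) <|
        Eventually.of_forall fun x => ?_).congr ?_
      · refine Measurable.mul (Finset.measurable_prod _ fun i _ => ?_) (hφ.comp (by fun_prop))
        have : Measurable fun x : Fin (n + 1) → ℝ =>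
            (t - ∑ j : Fin (n + 1), (if (j : ℕ) < i then x j else 0), x i) := by
          refine Measurable.prodMk (measurable_const.sub (Finset.measurable_sum _ fun j _ => ?_))
            (by fun_prop)
          split_ifs <;> fun_prop
        exact (hH _).comp this
      · have h0 : 0 ≤ ∏ i, H (Fin.rev i) (t - ∑ j : Fin _, if (j : ℕ) < i then x j else 0) (x i) :=
          Finset.prod_nonneg fun i _ => hH0 _ _ _
        rw [Real.norm_of_nonneg (mul_nonneg h0 (hφ0 _))]
        calc _ ≤ _ * 1 := mul_le_mul_of_nonneg_left (hφ1 _) h0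
          _ ≤ ∏ i : Fin (n + 1), C := by
            rw [mul_one]
            exact Finset.prod_le_prod (fun i _ => hH0 _ _ _) fun i _ => hHC _ _ _
          _ = _ := by simp
      · refine Eventually.of_forall fun x => ?_
        simp only [Finset.prod_mul_distrib]
        ring
    have hmp := (volume_preserving_piFinSuccAbove (fun _ : Fin (n + 1) => ℝ) 0).symm
    have hint' := (hmp.integrable_comp_emb (MeasurableEquiv.measurableEmbedding _)).2 hint
    rw [← hmp.integral_comp', Measure.volume_eq_prod]
    rw [Measure.volume_eq_prod] at hint'
    refine (integral_prod _ hint').trans ?_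
    rw [walkIntegral, integral_withDensity_eq_integral_toReal_smul₀
      hf.aestronglyMeasurable.aemeasurable.ennreal_ofReal (by simp)]
    refine integral_congr_ae (Eventually.of_forall fun x => ?_)
    dsimp only
    rw [ENNReal.toReal_ofReal (hf_nonneg x), ← ih, smul_eq_mul, ← integral_const_mul,
      ← integral_const_mul]
    refine integral_congr_ae (Eventually.of_forall fun y => ?_)
    simp only [Function.comp_apply, MeasurableEquiv.piFinSuccAbove_symm_apply, Fin.insertNthEquiv, Fin.prod_univ_succ,
      Equiv.coe_fn_mk, Fin.insertNth_zero', Fin.sum_univ_succ, Fin.cons_zero, Fin.cons_succ,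
      Fin.val_succ, Fin.val_zero, add_lt_add_iff_right, Nat.succ_pos, if_true, Fin.rev_zero,
      Fin.val_last, Nat.not_lt_zero, if_false, Finset.sum_const_zero, add_zero, sub_zero,
      Fin.rev_succ, Fin.val_castSucc, sub_sub]
    ring

/-- Likelihood ratio of one step of the conditional mixture algorithm, for a step distribution with
tail `G`: `m` is the number of steps remaining after this one, `t` the remaining distance to the
target level and `x` the size of the step. -/
noncomputable def mixWeight (G : ℝ → ℝ) (a : ℝ) (m : ℕ) (t x : ℝ) : ℝ :=
  if t < 0 then 1
  else if m = 0 then G t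
  else ((m : ℝ) / (m + 1) + 1 / (m + 1) * (if a * t < x then (G (a * t))⁻¹ else 0))⁻¹

/-- The probability that the sum of `m` independent variables with law `μ` exceeds `t`. -/
noncomputable def exceedProb (μ : Measure ℝ) : ℕ → ℝ → ℝ :=
  walkIntegral μ (fun _ _ _ => 1) fun t => if t < 0 then 1 else 0

/-- The second moment of the conditional mixture estimator with `m` remaining steps and remaining
distance `t`. -/
noncomputable def secondMoment (μ : Measure ℝ) (G : ℝ → ℝ) (a : ℝ) : ℕ → ℝ → ℝ :=
  walkIntegral μ (mixWeight G a) fun t => if t < 0 then 1 else 0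

section mixture

variable {G : ℝ → ℝ} {a : ℝ}

theorem mixWeight_nonneg (hG_pos : ∀ t, 0 < G t) (m : ℕ) (t x : ℝ) : 0 ≤ mixWeight G a m t x := by
  have h1 := hG_pos t
  have h2 := hG_pos (a * t)
  unfold mixWeight
  split_ifs <;> positivity

theorem mixWeight_le_two (hG_pos : ∀ t, 0 < G t) (hG_le : ∀ t, G t ≤ 1) (m : ℕ) (t x : ℝ) :
    mixWeight G a m t x ≤ 2 := by
  unfold mixWeight
  split_ifs with h1 h2 h3
  · norm_num
  · linarith [hG_le t]
  all_goals
    have hm : (1 : ℝ) ≤ m := by exact_mod_cast Nat.one_le_iff_ne_zero.2 h2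
    have hG := hG_pos (a * t)
    have hhalf : (2 : ℝ)⁻¹ ≤ m / (m + 1) := by
      rw [le_div_iff₀ (by positivity)]; linarith
    refine inv_le_of_inv_le₀ two_pos (hhalf.trans (le_add_of_nonneg_right ?_))
    positivity

theorem measurable_mixWeight (hG : Measurable G) (m : ℕ) :
    Measurable (Function.uncurry (mixWeight G a m)) := by
  have h1 : Measurable fun q : ℝ × ℝ => G q.1 := hG.comp measurable_fst
  have h2 : Measurable fun q : ℝ × ℝ => G (a * q.1) := hG.comp (by fun_prop)
  unfold mixWeight Function.uncurry
  refine Measurable.ite (measurableSet_lt measurable_fst measurable_const) measurable_const ?_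
  by_cases hm : m = 0
  · simpa only [hm, if_true] using h1
  · simp only [hm, if_false]
    refine Measurable.inv (measurable_const.add (measurable_const.mul ?_))
    exact Measurable.ite (measurableSet_lt (by fun_prop) measurable_snd) h2.inv measurable_const

variable {μ : Measure ℝ}

theorem measurable_neg_indicator : Measurable fun t : ℝ => if t < 0 then (1 : ℝ) else 0 :=
  Measurable.ite measurableSet_Iio measurable_const measurable_const

theorem neg_indicator_nonneg (t : ℝ) : (0 : ℝ) ≤ if t < 0 then (1 : ℝ) else 0 := by
  split_ifs <;> norm_num

theorem neg_indicator_le_one (t : ℝ) : (if t < 0 then (1 : ℝ) else 0) ≤ 1 := by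
  split_ifs <;> norm_num

theorem integral_one_indicator_Ioi (hG : ∀ t, G t = μ.real (Ioi t)) (s : ℝ) :
    ∫ x, (Ioi s).indicator 1 x ∂μ = G s := by
  rw [integral_indicator_one measurableSet_Ioi, hG]

theorem exceedProb_succ (m : ℕ) (t : ℝ) :
    exceedProb μ (m + 1) t = ∫ x, exceedProb μ m (t - x) ∂μ := by
  simp [exceedProb, walkIntegral]

theorem secondMoment_succ (m : ℕ) (t : ℝ) : secondMoment μ G a (m + 1) t =
    ∫ x, mixWeight G a m t x * secondMoment μ G a m (t - x) ∂μ := rfl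

theorem secondMoment_nonneg (hG_pos : ∀ t, 0 < G t) (m : ℕ) (t : ℝ) :
    0 ≤ secondMoment μ G a m t :=
  walkIntegral_nonneg (mixWeight_nonneg hG_pos) neg_indicator_nonneg m t

theorem exceedProb_one (hG : ∀ t, G t = μ.real (Ioi t)) (t : ℝ) : exceedProb μ 1 t = G t := by
  rw [exceedProb_succ, ← integral_one_indicator_Ioi hG t]
  refine integral_congr_ae (Eventually.of_forall fun x => ?_)
  simp [exceedProb, walkIntegral, indicator, sub_neg]

theorem secondMoment_one (hG : ∀ t, G t = μ.real (Ioi t)) {t : ℝ} (ht : 0 ≤ t) :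
    secondMoment μ G a 1 t = G t ^ 2 := by
  rw [secondMoment_succ, sq]
  have : G t * G t = ∫ x, G t * (Ioi t).indicator 1 x ∂μ := by
    rw [integral_const_mul, integral_one_indicator_Ioi hG]
  rw [this]
  refine integral_congr_ae (Eventually.of_forall fun x => ?_)
  simp [secondMoment, walkIntegral, indicator, sub_neg, mixWeight, not_lt.2 ht]

variable [IsProbabilityMeasure μ]

theorem integrable_one_indicator_Ioi (s : ℝ) :
    Integrable ((Ioi s).indicator (1 : ℝ → ℝ)) μ :=
  (integrable_const (1 : ℝ)).indicator measurableSet_Ioi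

theorem integrable_exceedProb (m : ℕ) (t : ℝ) :
    Integrable (fun x => exceedProb μ m (t - x)) μ := by
  simpa [exceedProb] using integrable_mul_walkIntegral (μ := μ) (H := fun _ _ _ => 1)
    (fun _ => measurable_const) measurable_neg_indicator (fun _ _ _ => zero_le_one)
    neg_indicator_nonneg zero_le_one (fun _ _ _ => le_rfl) neg_indicator_le_one m t

theorem antitone_tail (hG : ∀ t, G t = μ.real (Ioi t)) : Antitone G := fun s t hst => by
  rw [hG, hG]
  exact measureReal_mono (Ioi_subset_Ioi hst)

theorem tail_le_one (hG : ∀ t, G t = μ.real (Ioi t)) (t : ℝ) : G t ≤ 1 := by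
  rw [hG]; exact measureReal_le_one

theorem exceedProb_of_neg (hμ : ∀ᵐ x ∂μ, 0 < x) (m : ℕ) {t : ℝ} (ht : t < 0) :
    exceedProb μ m t = 1 := by
  induction m generalizing t with
  | zero => simp [exceedProb, walkIntegral, ht]
  | succ m ih =>
    have : ∀ᵐ x ∂μ, exceedProb μ m (t - x) = 1 := by
      filter_upwards [hμ] with x hx using ih (by linarith)
    rw [exceedProb_succ, integral_congr_ae this]
    simp

theorem secondMoment_of_neg (hμ : ∀ᵐ x ∂μ, 0 < x) (m : ℕ) {t : ℝ} (ht : t < 0) :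
    secondMoment μ G a m t = 1 := by
  induction m generalizing t with
  | zero => simp [secondMoment, walkIntegral, ht]
  | succ m ih =>
    have : ∀ᵐ x ∂μ, mixWeight G a m t x * secondMoment μ G a m (t - x) = 1 := by
      filter_upwards [hμ] with x hx
      rw [ih (by linarith), mixWeight, if_pos ht, mul_one]
    rw [secondMoment_succ, integral_congr_ae this]
    simp

theorem le_exceedProb (hμ : ∀ᵐ x ∂μ, 0 < x) (hG : ∀ t, G t = μ.real (Ioi t)) (m : ℕ) (t : ℝ) :
    1 - (1 - G t) ^ m ≤ exceedProb μ m t := by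
  induction m generalizing t with
  | zero => simpa [exceedProb, walkIntegral] using neg_indicator_nonneg t
  | succ m ih =>
    have h1 : ∫ x, ((1 - (1 - G t) ^ m) + (1 - G t) ^ m * (Ioi t).indicator 1 x) ∂μ =
        1 - (1 - G t) ^ (m + 1) := by
      rw [integral_add (integrable_const _) ((integrable_one_indicator_Ioi t).const_mul _),
        integral_const_mul, integral_one_indicator_Ioi hG]
      simp
      ring
    rw [exceedProb_succ, ← h1]
    refine integral_mono_ae
      ((integrable_const _).add ((integrable_one_indicator_Ioi t).const_mul _))
      (integrable_exceedProb m t) ?_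
    filter_upwards [hμ] with x hx
    by_cases hxt : t < x
    · rw [exceedProb_of_neg hμ m (by linarith), indicator_of_mem (mem_Ioi.2 hxt)]
      simp
    · rw [indicator_of_notMem (by simpa using hxt), mul_zero, add_zero]
      refine le_trans ?_ (ih _)
      have h2 : G t ≤ G (t - x) := antitone_tail hG (by linarith)
      have h3 := tail_le_one hG (t - x)
      have : (1 - G (t - x)) ^ m ≤ (1 - G t) ^ m := by
        gcongr
      linarith

theorem integrable_mul_secondMoment (hG_pos : ∀ t, 0 < G t) (hG : ∀ t, G t = μ.real (Ioi t))
    (m : ℕ) (t : ℝ) :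
    Integrable (fun x => mixWeight G a m t x * secondMoment μ G a m (t - x)) μ :=
  integrable_mul_walkIntegral (measurable_mixWeight (antitone_tail hG).measurable)
    measurable_neg_indicator (mixWeight_nonneg hG_pos) neg_indicator_nonneg zero_le_two
    (mixWeight_le_two hG_pos (tail_le_one hG)) neg_indicator_le_one m t

theorem secondMoment_le_pow (hG_pos : ∀ t, 0 < G t) (hG : ∀ t, G t = μ.real (Ioi t))
    (m : ℕ) (t : ℝ) : secondMoment μ G a m t ≤ 2 ^ m :=
  walkIntegral_le_pow (mixWeight_nonneg hG_pos) neg_indicator_nonneg zero_le_two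
    (mixWeight_le_two hG_pos (tail_le_one hG)) neg_indicator_le_one m t

/-- The second moment dominates the squared mean. -/
theorem sq_exceedProb_le_secondMoment (hμ : ∀ᵐ x ∂μ, 0 < x) (hG_pos : ∀ t, 0 < G t)
    (hG : ∀ t, G t = μ.real (Ioi t)) (m : ℕ) (t : ℝ) :
    exceedProb μ m t ^ 2 ≤ secondMoment μ G a m t := by
  rcases lt_or_ge t 0 with ht | ht
  · rw [exceedProb_of_neg hμ m ht, secondMoment_of_neg hμ m ht, one_pow]
  induction m generalizing t with
  | zero => simp [exceedProb, secondMoment, walkIntegral, not_lt.2 ht]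
  | succ m ih =>
    rcases Nat.eq_zero_or_pos m with rfl | hm
    · rw [exceedProb_one hG, secondMoment_one hG ht]
    have hm' : (0 : ℝ) < m := by exact_mod_cast hm
    set c := exceedProb μ (m + 1) t with hc
    set r : ℝ → ℝ := fun x =>
      (m : ℝ) / (m + 1) + 1 / (m + 1) * ((G (a * t))⁻¹ * (Ioi (a * t)).indicator 1 x) with hr
    have hGa := hG_pos (a * t)
    have hr_pos : ∀ x, 0 < r x := fun x => by
      have : 0 ≤ (Ioi (a * t)).indicator (1 : ℝ → ℝ) x := indicator_nonneg (by simp) x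
      positivity
    have hw : ∀ x, mixWeight G a m t x = (r x)⁻¹ := fun x => by
      simp [mixWeight, not_lt.2 ht, hm.ne', hr, indicator]
    have hr_int : Integrable r μ := (integrable_const _).add
      (((integrable_one_indicator_Ioi _).const_mul _).const_mul _)
    have hr_one : ∫ x, r x ∂μ = 1 := by
      rw [integral_add (integrable_const _)
        (((integrable_one_indicator_Ioi _).const_mul _).const_mul _), integral_const_mul,
        integral_const_mul, integral_one_indicator_Ioi hG]
      simp
      field_simp
    have hint := integrable_exceedProb (μ := μ) m t
    have h1 : ∫ x, (2 * c * exceedProb μ m (t - x) - c ^ 2 * r x) ∂μ = c ^ 2 := by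
      rw [integral_sub (hint.const_mul _) (hr_int.const_mul _), integral_const_mul,
        integral_const_mul, hr_one, ← exceedProb_succ, ← hc]
      ring
    rw [← h1, secondMoment_succ]
    refine integral_mono ((hint.const_mul _).sub (hr_int.const_mul _))
      (integrable_mul_secondMoment hG_pos hG m t) fun x => ?_
    have h2 : exceedProb μ m (t - x) ^ 2 ≤ secondMoment μ G a m (t - x) := by
      rcases lt_or_ge (t - x) 0 with h | h
      · rw [exceedProb_of_neg hμ m h, secondMoment_of_neg hμ m h, one_pow]
      · exact ih _ h
    have hrx := hr_pos x
    calc 2 * c * exceedProb μ m (t - x) - c ^ 2 * r x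
        ≤ (r x)⁻¹ * exceedProb μ m (t - x) ^ 2 := by
          rw [inv_mul_eq_div, le_div_iff₀ hrx]
          nlinarith [sq_nonneg (exceedProb μ m (t - x) - c * r x)]
      _ ≤ mixWeight G a m t x * secondMoment μ G a m (t - x) := by
          rw [hw]
          gcongr

theorem integrable_tailStep (c₀ c₁ c₂ c₃ s₁ s₂ s₃ : ℝ) :
    Integrable (fun x => c₀ + c₁ * (Ioi s₁).indicator 1 x +
      c₂ * ((Ioi s₂).indicator 1 x - (Ioi s₃).indicator 1 x) +
      c₃ * (Ioi s₃).indicator 1 x) μ :=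
  (((integrable_const c₀).add ((integrable_one_indicator_Ioi s₁).const_mul c₁)).add
    (((integrable_one_indicator_Ioi s₂).sub (integrable_one_indicator_Ioi s₃)).const_mul c₂)).add
    ((integrable_one_indicator_Ioi s₃).const_mul c₃)

theorem integral_tailStep (hG : ∀ t, G t = μ.real (Ioi t)) (c₀ c₁ c₂ c₃ s₁ s₂ s₃ : ℝ) :
    ∫ x, (c₀ + c₁ * (Ioi s₁).indicator 1 x +
      c₂ * ((Ioi s₂).indicator 1 x - (Ioi s₃).indicator 1 x) +
      c₃ * (Ioi s₃).indicator 1 x) ∂μ =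
    c₀ + c₁ * G s₁ + c₂ * (G s₂ - G s₃) + c₃ * G s₃ := by
  have hi := integrable_one_indicator_Ioi (μ := μ)
  have h1 : Integrable (fun x => c₁ * (Ioi s₁).indicator 1 x) μ := (hi s₁).const_mul c₁
  have h2 : Integrable (fun x => c₂ * ((Ioi s₂).indicator 1 x - (Ioi s₃).indicator 1 x)) μ :=
    ((hi s₂).sub (hi s₃)).const_mul c₂
  have h3 : Integrable (fun x => c₃ * (Ioi s₃).indicator 1 x) μ := (hi s₃).const_mul c₃
  have h4 : Integrable (fun x => c₀ + c₁ * (Ioi s₁).indicator 1 x) μ :=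
    (integrable_const c₀).add h1
  have h5 : Integrable (fun x => c₀ + c₁ * (Ioi s₁).indicator 1 x +
      c₂ * ((Ioi s₂).indicator 1 x - (Ioi s₃).indicator 1 x)) μ := h4.add h2
  rw [integral_add h5 h3, integral_add h4 h2, integral_add (integrable_const c₀) h1,
    integral_const_mul, integral_const_mul, integral_const_mul, integral_sub (hi s₂) (hi s₃)]
  simp only [integral_one_indicator_Ioi hG, integral_const, probReal_univ, one_smul]

theorem secondMoment_succ_le (hμ : ∀ᵐ x ∂μ, 0 < x) (hG_pos : ∀ t, 0 < G t)
    (hG : ∀ t, G t = μ.real (Ioi t)) {m : ℕ} (hm : 0 < m) {t : ℝ} (ht : 0 < t) (ha : a < 1)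
    {R : ℝ} (hR : 0 ≤ R) (hV : ∀ x ≤ a * t, secondMoment μ G a m (t - x) ≤ R * G (t - x) ^ 2)
    (ε : ℝ) :
    secondMoment μ G a (m + 1) t ≤
      (m + 1) / m * R * (G ((1 - ε) * t) ^ 2 + G ((1 - a) * t) ^ 2 * G (ε * t)) +
        (m + 1) * G (a * t) * (2 ^ m * (G (a * t) - G t) + G t) := by
  have hm' : (0 : ℝ) < m := by exact_mod_cast hm
  have hGa := hG_pos (a * t)
  have hanti := antitone_tail hG
  have hat : a * t < t := by nlinarith
  have h1 : ∫ x, ((m + 1) / m * R * G ((1 - ε) * t) ^ 2 +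
        (m + 1) / m * R * G ((1 - a) * t) ^ 2 * (Ioi (ε * t)).indicator 1 x +
        (m + 1) * G (a * t) * 2 ^ m *
          ((Ioi (a * t)).indicator 1 x - (Ioi t).indicator 1 x) +
        (m + 1) * G (a * t) * (Ioi t).indicator 1 x) ∂μ =
      (m + 1) / m * R * (G ((1 - ε) * t) ^ 2 + G ((1 - a) * t) ^ 2 * G (ε * t)) +
        (m + 1) * G (a * t) * (2 ^ m * (G (a * t) - G t) + G t) := by
    rw [integral_tailStep hG]
    ring
  rw [← h1, secondMoment_succ]
  refine integral_mono (integrable_mul_secondMoment hG_pos hG m t)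
    (integrable_tailStep _ _ _ _ _ _ _) fun x => ?_
  dsimp only
  rcases le_or_gt x (a * t) with hx | hx
  · have hxt : x ≤ t := hx.trans hat.le
    have hw : mixWeight G a m t x = (m + 1) / m := by
      simp [mixWeight, not_lt.2 ht.le, hm.ne', not_lt.2 hx]
    rw [indicator_of_notMem (s := Ioi (a * t)) (by simpa using hx),
      indicator_of_notMem (s := Ioi t) (by simpa using hxt), hw]
    have hstep : (m + 1) / m * secondMoment μ G a m (t - x) ≤
        ((m : ℝ) + 1) / m * (R * G (t - x) ^ 2) := by
      gcongr
      exact hV x hx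
    refine hstep.trans ?_
    have hG0 := (hG_pos (t - x)).le
    rcases le_or_gt x (ε * t) with hxe | hxe
    · rw [indicator_of_notMem (by simpa using hxe)]
      have : G (t - x) ≤ G ((1 - ε) * t) := hanti (by linarith)
      simp only [mul_zero, sub_zero, add_zero]
      rw [mul_assoc]
      gcongr
    · rw [indicator_of_mem (mem_Ioi.2 hxe)]
      have : G (t - x) ≤ G ((1 - a) * t) := hanti (by linarith)
      have h2 : ((m : ℝ) + 1) / m * (R * G (t - x) ^ 2) ≤
          (m + 1) / m * R * G ((1 - a) * t) ^ 2 := by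
        rw [mul_assoc]
        gcongr
      have h3 : 0 ≤ ((m : ℝ) + 1) / m * R * G ((1 - ε) * t) ^ 2 := by positivity
      simp only [mul_zero, sub_zero, add_zero, Pi.one_apply, mul_one]
      linarith
  · have hw : mixWeight G a m t x ≤ (m + 1) * G (a * t) := by
      rw [mixWeight, if_neg (not_lt.2 ht.le), if_neg hm.ne', if_pos hx]
      have : (((m : ℝ) + 1) * G (a * t)) = (1 / ((m : ℝ) + 1) * (G (a * t))⁻¹)⁻¹ := by
        field_simp
      rw [this]
      gcongr
      exact le_add_of_nonneg_left (by positivity)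
    have hV0 := secondMoment_nonneg (μ := μ) (a := a) hG_pos m (t - x)
    have hie : 0 ≤ (Ioi (ε * t)).indicator (1 : ℝ → ℝ) x := indicator_nonneg (by simp) x
    have h0 : 0 ≤ ((m : ℝ) + 1) / m * R * G ((1 - ε) * t) ^ 2 +
        (m + 1) / m * R * G ((1 - a) * t) ^ 2 * (Ioi (ε * t)).indicator 1 x := by positivity
    have hprod := mul_le_mul_of_nonneg_right hw hV0
    refine hprod.trans ?_
    rw [indicator_of_mem (s := Ioi (a * t)) (mem_Ioi.2 hx)]
    rcases lt_or_ge t x with hxt | hxt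
    · rw [indicator_of_mem (s := Ioi t) (mem_Ioi.2 hxt), secondMoment_of_neg hμ m (by linarith)]
      simp only [Pi.one_apply, sub_self, mul_zero, mul_one, add_zero]
      linarith
    · rw [indicator_of_notMem (s := Ioi t) (by simpa using hxt)]
      have h2 := secondMoment_le_pow (μ := μ) (a := a) hG_pos hG m (t - x)
      have h3 : ((m : ℝ) + 1) * G (a * t) * secondMoment μ G a m (t - x) ≤
        (m + 1) * G (a * t) * 2 ^ m := by gcongr
      simp only [Pi.one_apply, sub_zero, mul_one, mul_zero, add_zero]
      linarith

end mixture

/-- Consequences of the order of the level parameter `a = 1 - r`: every relevant remaining distance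
`t` is large, and `r t` dominates a power of `t` with exponent larger than `1 / 2`. -/
theorem exists_rpow_le_mul {r : ℝ → ℝ} {N : ℕ} {β c : ℝ} (hβ : 0 < β) (hNβ : (N + 2) * β < 1)
    (hc : 0 < c) (hr : ∀ᶠ b in atTop, c * b ^ (-β) ≤ r b) :
    Tendsto (fun b => r b ^ N * b) atTop atTop ∧
      ∃ θ > (1 / 2 : ℝ), ∀ᶠ b in atTop, ∀ t ≥ r b ^ N * b, t ^ θ ≤ r b * t := by
  have hlow : ∀ᶠ b in atTop, c ^ N * b ^ (1 - N * β) ≤ r b ^ N * b := by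
    filter_upwards [hr, eventually_gt_atTop 0] with b hb hb0
    have h1 : (b ^ (-β)) ^ N * b = b ^ (1 - N * β) := by
      rw [← rpow_natCast, ← rpow_mul hb0.le, ← rpow_add_one hb0.ne']
      ring_nf
    rw [← h1, ← mul_assoc, ← mul_pow]
    gcongr
  have hexp : 0 < 1 - N * β := by nlinarith
  refine ⟨tendsto_atTop_mono' _ hlow
    ((tendsto_rpow_atTop hexp).const_mul_atTop (pow_pos hc N)), ?_⟩
  obtain ⟨γ, hγ1, hγ2⟩ : ∃ γ, β / (1 - N * β) < γ ∧ γ < 1 / 2 :=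
    exists_between (by rw [div_lt_iff₀ hexp]; linarith)
  rw [div_lt_iff₀ hexp] at hγ1
  have hγ0 : 0 < γ := by nlinarith
  refine ⟨1 - γ, by linarith, ?_⟩
  have hlarge := ((tendsto_rpow_atTop (sub_pos.2 hγ1)).const_mul_atTop
    (mul_pos (rpow_pos_of_pos (pow_pos hc N) γ) hc)).eventually_ge_atTop 1
  filter_upwards [hlow, hr, hlarge, eventually_gt_atTop 0] with b hb1 hb2 hb3 hb0 t ht
  have hpos : 0 < c ^ N * b ^ (1 - N * β) := by positivity
  have ht0 : 0 < t := hpos.trans_le (hb1.trans ht)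
  have h1 : 1 ≤ t ^ γ * r b :=
    calc 1 ≤ (c ^ N) ^ γ * c * b ^ (γ * (1 - N * β) - β) := hb3
      _ = (c ^ N * b ^ (1 - N * β)) ^ γ * (c * b ^ (-β)) := by
        rw [mul_rpow (by positivity) (by positivity), ← rpow_mul hb0.le, sub_eq_add_neg,
          rpow_add hb0, mul_comm γ]
        ring
      _ ≤ t ^ γ * r b := by
        gcongr
        exact hb1.trans ht
  calc t ^ (1 - γ) ≤ t ^ (1 - γ) * (t ^ γ * r b) := le_mul_of_one_le_right (by positivity) h1
    _ = t ^ (1 - γ + γ) * r b := by rw [rpow_add ht0]; ring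
    _ = r b * t := by rw [sub_add_cancel, rpow_one, mul_comm]

theorem eventually_secondMoment_le {μ : Measure ℝ} [IsProbabilityMeasure μ] {G : ℝ → ℝ} {α : ℝ}
    (hμ : ∀ᵐ x ∂μ, 0 < x) (hG_pos : ∀ t, 0 < G t) (hG : ∀ t, G t = μ.real (Ioi t)) (hα : 0 < α)
    (hrv : ∀ x : ℝ, 0 < x → Tendsto (fun u => G (x * u) / G u) atTop (nhds (x ^ (-α))))
    {a : ℝ → ℝ} (ha : ∀ b, a b ∈ Ioo (0 : ℝ) 1) (ha1 : Tendsto a atTop (nhds 1)) {n : ℕ}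
    (hlevel : Tendsto (fun b => (1 - a b) ^ (n - 2) * b) atTop atTop) {θ : ℝ} (hθ : 1 / 2 < θ)
    (hpow : ∀ᶠ b in atTop, ∀ t ≥ (1 - a b) ^ (n - 2) * b, t ^ θ ≤ (1 - a b) * t)
    {k : ℕ} (hk : k + 1 ≤ n) {ρ : ℝ} (hρ : 1 < ρ) :
    ∀ᶠ b in atTop, ∀ t ≥ (1 - a b) ^ (n - (k + 1)) * b,
      secondMoment μ G (a b) (k + 1) t ≤ ρ * ((k : ℝ) + 1) ^ 2 * G t ^ 2 := by
  have hanti := antitone_tail hG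
  induction k generalizing ρ with
  | zero =>
    filter_upwards [eventually_ge_atTop 0] with b hb t ht
    have h0 : 0 < 1 - a b := sub_pos.2 (ha b).2
    have ht0 : 0 ≤ t := le_trans (by positivity) ht
    rw [secondMoment_one hG ht0]
    have := sq_nonneg (G t)
    push_cast
    nlinarith
  | succ k ih =>
    set m := k + 1 with hm
    have hm0 : 0 < m := Nat.succ_pos k
    have hm' : (0 : ℝ) < m := by exact_mod_cast hm0
    obtain ⟨ρ', hρ'1, hρ'⟩ : ∃ ρ' > 1, ((m : ℝ) + 1) / m * (ρ' * (m : ℝ) ^ 2) *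
        (ρ' ^ 2 + (ρ' - 1)) + (m + 1) * ρ' * (2 ^ m * (ρ' - 1) + 1) < ρ * ((m : ℝ) + 1) ^ 2 := by
      have hcont : Tendsto (fun ρ' : ℝ => ((m : ℝ) + 1) / m * (ρ' * (m : ℝ) ^ 2) *
          (ρ' ^ 2 + (ρ' - 1)) + (m + 1) * ρ' * (2 ^ m * (ρ' - 1) + 1)) (nhdsWithin 1 (Ioi 1))
          (nhds (((m : ℝ) + 1) / m * (1 * (m : ℝ) ^ 2) *
          (1 ^ 2 + (1 - 1)) + (m + 1) * 1 * (2 ^ m * (1 - 1) + 1))) :=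
        (Continuous.tendsto (by fun_prop) 1).mono_left nhdsWithin_le_nhds
      have hlt : ((m : ℝ) + 1) / m * (1 * (m : ℝ) ^ 2) *
          (1 ^ 2 + (1 - 1)) + (m + 1) * 1 * (2 ^ m * (1 - 1) + 1) < ρ * ((m : ℝ) + 1) ^ 2 := by
        have : ((m : ℝ) + 1) / m * (1 * (m : ℝ) ^ 2) *
          (1 ^ 2 + (1 - 1)) + (m + 1) * 1 * (2 ^ m * (1 - 1) + 1) = ((m : ℝ) + 1) ^ 2 := by
          field_simp
          ring
        rw [this]
        exact lt_mul_of_one_lt_left (by positivity) hρ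
      obtain ⟨ρ', h1, h2⟩ := ((hcont.eventually (gt_mem_nhds hlt)).and self_mem_nhdsWithin).exists
      exact ⟨ρ', h2, h1⟩
    obtain ⟨ε, hε0, hε1, hε⟩ : ∃ ε, 0 < ε ∧ ε < 1 ∧ (1 - ε : ℝ) ^ (-α) < ρ' := by
      have hcont : Tendsto (fun ε : ℝ => (1 - ε) ^ (-α)) (nhdsWithin 0 (Ioi 0))
          (nhds ((1 - 0 : ℝ) ^ (-α))) := by
        refine Tendsto.mono_left ?_ nhdsWithin_le_nhds
        exact (tendsto_const_nhds.sub tendsto_id).rpow_const (Or.inl (by norm_num))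
      have h0 : (1 - 0 : ℝ) ^ (-α) < ρ' := by simpa using hρ'1
      have hlt : ∀ᶠ ε : ℝ in nhdsWithin 0 (Ioi 0), ε < 1 :=
        nhdsWithin_le_nhds (gt_mem_nhds one_pos)
      obtain ⟨ε, h1, h2, h3⟩ :=
        (hlt.and ((hcont.eventually (gt_mem_nhds h0)).and self_mem_nhdsWithin)).exists
      exact ⟨ε, h3, h1, h2⟩
    have hM : 0 < ε ^ (-α) + 1 := by positivity
    have hτ : 0 < (ρ' - 1) / (ε ^ (-α) + 1) := div_pos (sub_pos.2 hρ'1) hM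
    obtain ⟨T, hT⟩ := eventually_atTop.1 <|
      ((hrv (1 - ε) (by linarith)).eventually (gt_mem_nhds hε)).and <|
      ((hrv ε hε0).eventually (gt_mem_nhds (lt_add_one _))).and <|
      ((tendsto_sq_rpow_div_of_regularlyVarying hanti hG_pos hα (hrv 2 two_pos) hθ).eventually
        (gt_mem_nhds hτ)).and (eventually_gt_atTop (0 : ℝ))
    filter_upwards [ih (by lia) hρ'1, hlevel.eventually_ge_atTop T, hpow,
      ha1.eventually (lt_mem_nhds (show 1 - ε < 1 by linarith)), eventually_ge_atTop 0]
      with b hVb hTb hpb hab hb0 t ht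
    obtain ⟨ha0, ha1b⟩ := ha b
    have hr0 : 0 < 1 - a b := sub_pos.2 ha1b
    have hlev : (1 - a b) ^ (n - 2) * b ≤ t := by
      refine le_trans ?_ ht
      gcongr ?_ * b
      exact pow_le_pow_of_le_one hr0.le (by linarith) (by lia)
    obtain ⟨h1, h2, h3, ht0⟩ := hT t (hTb.trans hlev)
    have hg := hG_pos t
    rw [div_lt_iff₀ hg] at h1 h2 h3
    have hstep := secondMoment_succ_le (μ := μ) (a := a b) hμ hG_pos hG hm0 ht0 ha1b
      (R := ρ' * (m : ℝ) ^ 2) (by positivity) (fun x hx => by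
        have := hVb (t - x) ?_
        · simpa [hm] using this
        · have hexp : n - m = n - (m + 1) + 1 := by lia
          rw [hexp, pow_succ']
          calc (1 - a b) * (1 - a b) ^ (n - (m + 1)) * b
              = (1 - a b) * ((1 - a b) ^ (n - (m + 1)) * b) := by ring
            _ ≤ (1 - a b) * t := by gcongr
            _ ≤ t - x := by linarith) ε
    have h4 : G ((1 - a b) * t) ^ 2 * G (ε * t) ≤ (ρ' - 1) * G t ^ 2 := by
      have h5 : G ((1 - a b) * t) ≤ G (t ^ θ) := hanti (hpb t hlev)
      have h6 := hG_pos ((1 - a b) * t)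
      have h7 := hG_pos (ε * t)
      calc G ((1 - a b) * t) ^ 2 * G (ε * t) ≤ G (t ^ θ) ^ 2 * G (ε * t) := by gcongr
        _ ≤ ((ρ' - 1) / (ε ^ (-α) + 1) * G t) * ((ε ^ (-α) + 1) * G t) := by gcongr
        _ = _ := by field_simp
    have h5 : G (a b * t) ≤ ρ' * G t :=
      (hanti (by gcongr : (1 - ε) * t ≤ a b * t)).trans h1.le
    have h6 : G t ≤ G (a b * t) := hanti (by nlinarith)
    have h7 := hG_pos ((1 - ε) * t)
    have h8 := hG_pos (a b * t)
    calc _ ≤ _ := hstep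
      _ ≤ ((m : ℝ) + 1) / m * (ρ' * (m : ℝ) ^ 2) * ((ρ' * G t) ^ 2 + (ρ' - 1) * G t ^ 2) +
          (m + 1) * (ρ' * G t) * (2 ^ m * (ρ' * G t - G t) + G t) := by
        have h9 : 0 ≤ G (a b * t) - G t := sub_nonneg.2 h6
        have h10 : 0 < ρ' := by linarith
        gcongr
      _ = (((m : ℝ) + 1) / m * (ρ' * (m : ℝ) ^ 2) * (ρ' ^ 2 + (ρ' - 1)) +
          (m + 1) * ρ' * (2 ^ m * (ρ' - 1) + 1)) * G t ^ 2 := by ring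
      _ ≤ ρ * ((m : ℝ) + 1) ^ 2 * G t ^ 2 := by gcongr

/-- If the second moment is at most `(1 + o(1)) n² G²`, then it is equivalent to the squared
probability. -/
theorem tendsto_secondMoment_div_sq {μ : Measure ℝ} [IsProbabilityMeasure μ] {G a : ℝ → ℝ}
    (hμ : ∀ᵐ x ∂μ, 0 < x) (hG_pos : ∀ t, 0 < G t) (hG : ∀ t, G t = μ.real (Ioi t))
    (hG_lim : Tendsto G atTop (nhds 0)) {n : ℕ} (hn : 0 < n)
    (hV : ∀ ρ > 1, ∀ᶠ b in atTop, secondMoment μ G (a b) n b ≤ ρ * (n : ℝ) ^ 2 * G b ^ 2) :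
    Tendsto (fun b => secondMoment μ G (a b) n b / exceedProb μ n b ^ 2) atTop (nhds 1) := by
  have hn' : (0 : ℝ) < n := by exact_mod_cast hn
  set s : ℝ → ℝ := fun b => ∑ j ∈ Finset.range n, (1 - G b) ^ j with hs
  have hU : ∀ b, G b * s b ≤ exceedProb μ n b := fun b => by
    refine le_trans (le_of_eq ?_) (le_exceedProb hμ hG n b)
    have := mul_neg_geom_sum (1 - G b) n
    rw [sub_sub_cancel] at this
    exact this
  have hs_pos : ∀ b, 0 < s b := fun b => by
    have h1 : ∀ j, 0 ≤ (1 - G b) ^ j := fun j => pow_nonneg (sub_nonneg.2 (tail_le_one hG b)) j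
    refine Finset.sum_pos' (fun j _ => h1 j) ⟨0, Finset.mem_range.2 hn, by simp⟩
  have hU_pos : ∀ b, 0 < exceedProb μ n b := fun b =>
    (mul_pos (hG_pos b) (hs_pos b)).trans_le (hU b)
  have hs_lim : Tendsto s atTop (nhds n) := by
    have : Tendsto s atTop (nhds (∑ j ∈ Finset.range n, (1 - 0 : ℝ) ^ j)) :=
      tendsto_finsetSum _ fun j _ => (tendsto_const_nhds.sub hG_lim).pow j
    simpa using this
  rw [tendsto_order]
  refine ⟨fun l hl => Eventually.of_forall fun b => hl.trans_le ?_, fun u hu => ?_⟩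
  · rw [one_le_div (pow_pos (hU_pos b) 2)]
    exact sq_exceedProb_le_secondMoment hμ hG_pos hG n b
  · obtain ⟨ρ, hρ1, hρu⟩ := exists_between hu
    have hlim : Tendsto (fun b => ρ * (n : ℝ) ^ 2 / s b ^ 2) atTop
        (nhds (ρ * (n : ℝ) ^ 2 / (n : ℝ) ^ 2)) :=
      tendsto_const_nhds.div (hs_lim.pow 2) (by positivity)
    rw [mul_div_cancel_right₀ _ (by positivity)] at hlim
    filter_upwards [hV ρ hρ1, hlim.eventually (gt_mem_nhds hρu)] with b hb1 hb2
    refine lt_of_le_of_lt ?_ hb2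
    have h1 := hs_pos b
    have h2 := hG_pos b
    calc _ ≤ ρ * (n : ℝ) ^ 2 * G b ^ 2 / (G b * s b) ^ 2 := by
          gcongr
          exact hU b
      _ = ρ * (n : ℝ) ^ 2 / s b ^ 2 := by
          field_simp

theorem sum_lt_succ {n : ℕ} (y : Fin n → ℝ) (i : Fin n) :
    (∑ j : Fin n, if (j : ℕ) < (i : ℕ) + 1 then y j else 0) =
      (∑ j : Fin n, if (j : ℕ) < i then y j else 0) + y i := by
  have h : y i = ∑ j : Fin n, if j = i then y j else 0 := by simp
  rw [h, ← Finset.sum_add_distrib]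
  refine Finset.sum_congr rfl fun j _ => ?_
  rcases lt_trichotomy j i with hj | rfl | hj
  · have h1 : (j : ℕ) < i := hj
    simp [h1, hj.ne, h1.trans (Nat.lt_succ_self _)]
  · simp
  · have h1 : ¬ (j : ℕ) < i := not_lt.2 (le_of_lt hj)
    have h2 : ¬ (j : ℕ) < i + 1 := by have : (i : ℕ) < j := hj; lia
    simp [h1, h2, hj.ne']

theorem setIntegral_gt_sum_eq {n : ℕ} (F : (Fin n → ℝ) → ℝ) (b : ℝ) :
    ∫ x in {x : Fin n → ℝ | b < ∑ j, x j}, F x =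
      ∫ x, F x * if b - ∑ j, x j < 0 then 1 else 0 := by
  rw [← integral_indicator (measurableSet_lt measurable_const (by fun_prop))]
  refine integral_congr_ae (Eventually.of_forall fun x => ?_)
  simp [indicator, sub_neg]

theorem measurableSet_gt_sum {n : ℕ} (b : ℝ) :
    MeasurableSet {x : Fin n → ℝ | b < ∑ j, x j} :=
  measurableSet_lt measurable_const (by fun_prop)

section density

variable {f : ℝ → ℝ}

theorem isProbabilityMeasure_withDensity_ofReal (hf_nonneg : ∀ x, 0 ≤ f x) (hf : Integrable f)
    (hf_int : ∫ x, f x = 1) :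
    IsProbabilityMeasure (volume.withDensity fun x => ENNReal.ofReal (f x)) := by
  refine ⟨?_⟩
  rw [withDensity_apply _ MeasurableSet.univ, Measure.restrict_univ,
    ← ofReal_integral_eq_lintegral_ofReal hf (Eventually.of_forall hf_nonneg), hf_int,
    ENNReal.ofReal_one]

theorem withDensity_ofReal_real_Ioi (hf_nonneg : ∀ x, 0 ≤ f x) (hf : Integrable f) (t : ℝ) :
    (volume.withDensity fun x => ENNReal.ofReal (f x)).real (Ioi t) = ∫ x in Ioi t, f x := by
  rw [Measure.real, withDensity_apply _ measurableSet_Ioi,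
    ← ofReal_integral_eq_lintegral_ofReal hf.integrableOn (Eventually.of_forall hf_nonneg),
    ENNReal.toReal_ofReal (integral_nonneg hf_nonneg)]

theorem ae_pos_withDensity_ofReal (hf : Integrable f) (hf_supp : ∀ x ≤ (0 : ℝ), f x = 0) :
    ∀ᵐ x ∂(volume.withDensity fun x => ENNReal.ofReal (f x)), 0 < x := by
  rw [ae_withDensity_iff' hf.aestronglyMeasurable.aemeasurable.ennreal_ofReal]
  refine Eventually.of_forall fun x hx => ?_
  by_contra hx0
  exact hx (by simp [hf_supp x (not_lt.1 hx0)])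

theorem setIntegral_prod_eq_exceedProb (hf_nonneg : ∀ x, 0 ≤ f x) (hf : Integrable f) {n : ℕ}
    (b : ℝ) : ∫ x in {x : Fin n → ℝ | b < ∑ j, x j}, ∏ i, f (x i) =
      exceedProb (volume.withDensity fun x => ENNReal.ofReal (f x)) n b := by
  rw [exceedProb, ← integral_eq_walkIntegral hf_nonneg hf (fun _ => measurable_const)
    measurable_neg_indicator (fun _ _ _ => zero_le_one) neg_indicator_nonneg
    (fun _ _ _ => le_rfl) neg_indicator_le_one, setIntegral_gt_sum_eq]
  simp

theorem setIntegral_prod_mixWeight_eq_secondMoment (hf_nonneg : ∀ x, 0 ≤ f x)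
    (hf : Integrable f) {G : ℝ → ℝ} (hG_pos : ∀ t, 0 < G t) (hG_le : ∀ t, G t ≤ 1)
    (hG : Measurable G) (a : ℝ) {n : ℕ} (b : ℝ) :
    ∫ x in {x : Fin n → ℝ | b < ∑ j, x j}, ∏ i, f (x i) *
        mixWeight G a (Fin.rev i) (b - ∑ j : Fin n, if (j : ℕ) < i then x j else 0) (x i) =
      secondMoment (volume.withDensity fun x => ENNReal.ofReal (f x)) G a n b := by
  rw [secondMoment, ← integral_eq_walkIntegral hf_nonneg hf (measurable_mixWeight hG)
    measurable_neg_indicator (mixWeight_nonneg hG_pos) neg_indicator_nonneg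
    (mixWeight_le_two hG_pos hG_le) neg_indicator_le_one, setIntegral_gt_sum_eq]

end density

/-- The conditional mixture algorithm with p_i = (n-i)/(n-i+1) and
1 - a_b of exact order b^(-1/(2(n-1))+δ) has asymptotically optimal
relative error: E p̂_b² / p_b² → 1. -/
theorem stmt_2
    (n : ℕ) (hn : 2 ≤ n) (α : ℝ) (hα : 0 < α)
    (f : ℝ → ℝ) (hf_nonneg : ∀ x, 0 ≤ f x)
    (hf_int : ∫ x, f x = 1)
    (hf_supp : ∀ x ≤ (0 : ℝ), f x = 0)
    (hf_rv : ∀ x : ℝ, 0 < x →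
      Tendsto (fun u => f (u * x) / f u) atTop (nhds (x ^ (-α - 1))))
    (Fbar : ℝ → ℝ) (hFbar : ∀ b, Fbar b = ∫ t in Ioi b, f t)
    (hFbar_pos : ∀ b, 0 < Fbar b)
    -- the level parameter a = a_b ∈ (0,1), with 1 - a_b of exact order
    -- b^(-1/(2(n-1)) + δ) for some 0 < δ < 1/(2(n-1))
    (δ : ℝ) (hδ : 0 < δ) (hδ' : δ < 1 / (2 * ((n : ℝ) - 1)))
    (a : ℝ → ℝ) (ha : ∀ b, a b ∈ Ioo (0 : ℝ) 1)
    (horder : ∃ c₁ > (0 : ℝ), ∃ c₂ : ℝ, ∀ᶠ b in atTop,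
      c₁ * b ^ (-(1 / (2 * ((n : ℝ) - 1))) + δ) ≤ 1 - a b ∧
      1 - a b ≤ c₂ * b ^ (-(1 / (2 * ((n : ℝ) - 1))) + δ))
    -- mixing probabilities p_i = (n-i)/(n-i+1)
    (p : ℕ → ℝ) (hp : ∀ i, 1 ≤ i → i < n → p i = ((n : ℝ) - i) / ((n : ℝ) - i + 1))
    -- conditional mixture densities
    (g : ℕ → ℝ → ℝ → ℝ → ℝ)
    (hg : ∀ i, 1 ≤ i → i < n → ∀ b s x, g i b s x =
      if a b * (b - s) < x then f x / Fbar (a b * (b - s)) else 0)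
    (hgn : ∀ b s x, g n b s x = if b - s < x then f x / Fbar (b - s) else 0)
    (ψ : ℕ → ℝ → ℝ → ℝ → ℝ)
    (hψ : ∀ i b s x, ψ i b s x =
      if b < s then f x
      else if i < n then p i * f x + (1 - p i) * g i b s x
      else g i b s x)
    (S : (Fin n → ℝ) → ℕ → ℝ)
    (hS : ∀ y k, S y k = ∑ j ∈ Finset.univ.filter (fun j : Fin n => (j : ℕ) < k), y j)
    (pb : ℝ → ℝ)
    (hpb : ∀ b, pb b = ∫ x in {x : Fin n → ℝ | b < S x n}, ∏ i : Fin n, f (x i))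
    (Ep2 : ℝ → ℝ)
    (hEp2 : ∀ b, Ep2 b = ∫ x in {x : Fin n → ℝ | b < S x n},
      ∏ i : Fin n, (f (x i)) ^ 2 / ψ ((i : ℕ) + 1) b (S x (i : ℕ)) (x i)) :
    Tendsto (fun b => Ep2 b / (pb b) ^ 2) atTop (nhds 1) := by
  have hf : Integrable f := by
    by_contra h
    rw [integral_undef h] at hf_int
    exact zero_ne_one hf_int
  set μ : Measure ℝ := volume.withDensity fun x => ENNReal.ofReal (f x)
  have : IsProbabilityMeasure μ := isProbabilityMeasure_withDensity_ofReal hf_nonneg hf hf_int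
  have hG : ∀ t, Fbar t = μ.real (Ioi t) := fun t => by
    rw [hFbar, withDensity_ofReal_real_Ioi hf_nonneg hf]
  have hμ : ∀ᵐ x ∂μ, 0 < x := ae_pos_withDensity_ofReal hf hf_supp
  have hanti := antitone_tail hG
  have hrv : ∀ x : ℝ, 0 < x →
      Tendsto (fun u => Fbar (x * u) / Fbar u) atTop (nhds (x ^ (-α))) := fun x hx =>
    tendsto_tail_ratio hf_nonneg hf hf_rv hFbar hFbar_pos hx
  have hSif : ∀ (y : Fin n → ℝ) (k : ℕ), S y k = ∑ j : Fin n, if (j : ℕ) < k then y j else 0 :=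
    fun y k => by rw [hS, Finset.sum_filter]
  have hSn : ∀ y, S y n = ∑ j, y j := fun y => by simp [hSif]
  have hpb' : ∀ b, pb b = exceedProb μ n b := fun b => by
    rw [hpb, ← setIntegral_prod_eq_exceedProb hf_nonneg hf]
    simp only [hSn]
  have hE : ∀ b, Ep2 b = secondMoment μ Fbar (a b) n b := fun b => by
    rw [hEp2, ← setIntegral_prod_mixWeight_eq_secondMoment hf_nonneg hf hFbar_pos
      (tail_le_one hG) hanti.measurable]
    simp only [hSn]
    refine setIntegral_congr_fun (measurableSet_gt_sum b) fun x hx => ?_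
    refine Finset.prod_congr rfl fun i _ => ?_
    rw [← hSif, hψ, mixWeight]
    by_cases hs : b < S x i
    · rw [if_pos hs, if_pos (sub_neg.2 hs), sq, mul_one, mul_self_div_self]
    have hs' : ¬ b - S x i < 0 := by linarith [not_lt.1 hs]
    rw [if_neg hs, if_neg hs']
    rcases Nat.lt_or_ge ((i : ℕ) + 1) n with hi | hi
    · have hrev : ((Fin.rev i : Fin n) : ℕ) = n - (i + 1) := Fin.val_rev i
      have hcast : ((n - (i + 1) : ℕ) : ℝ) = (n : ℝ) - ((i + 1 : ℕ) : ℝ) := Nat.cast_sub hi.le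
      have hpos : (0 : ℝ) < (n : ℝ) - ((i + 1 : ℕ) : ℝ) := by
        rw [sub_pos]; exact_mod_cast hi
      rw [if_pos hi, hrev, if_neg (by lia), hcast, hp _ (by lia) hi, hg _ (by lia) hi]
      rcases (hf_nonneg (x i)).eq_or_lt with h0 | h0
      · simp [← h0]
      have hF := hFbar_pos (a b * (b - S x i))
      set q := (n : ℝ) - ((i + 1 : ℕ) : ℝ)
      have hq1 : 1 - q / (q + 1) = 1 / (q + 1) := by field_simp; ring
      rw [hq1]
      split_ifs
      · field_simp
      · simp only [mul_zero, add_zero]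
        field_simp
    · have hin : (i : ℕ) + 1 = n := le_antisymm i.isLt hi
      have hrev : ((Fin.rev i : Fin n) : ℕ) = 0 := by rw [Fin.val_rev, hin, Nat.sub_self]
      have hx' : b - S x i < x i := by
        have h1 : S x ((i : ℕ) + 1) = S x i + x i := by
          rw [hSif, hSif, sum_lt_succ]
        rw [hin, hSn] at h1
        have h2 : b < ∑ j, x j := hx
        linarith
      rw [if_neg (not_lt.2 hi), hrev, if_pos rfl, hin, hgn, if_pos hx']
      rcases (hf_nonneg (x i)).eq_or_lt with h0 | h0
      · simp [← h0]
      have hF := hFbar_pos (b - S x i)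
      field_simp
  have hn1 : (0 : ℝ) < (n : ℝ) - 1 := by
    have : (2 : ℝ) ≤ n := by exact_mod_cast hn
    linarith
  set β : ℝ := 1 / (2 * ((n : ℝ) - 1)) - δ with hβ
  have hβ0 : 0 < β := sub_pos.2 hδ'
  have hexp : -(1 / (2 * ((n : ℝ) - 1))) + δ = -β := by rw [hβ]; ring
  rw [hexp] at horder
  obtain ⟨c₁, hc₁, c₂, hc⟩ := horder
  have hNβ : (((n - 2 : ℕ) : ℝ) + 2) * β < 1 := by
    have h2 : (2 : ℝ) ≤ n := by exact_mod_cast hn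
    rw [Nat.cast_sub hn, Nat.cast_ofNat, sub_add_cancel]
    have h3 : β < 1 / (2 * ((n : ℝ) - 1)) := by linarith
    rw [lt_div_iff₀ (by positivity)] at h3
    nlinarith
  obtain ⟨hlevel, θ, hθ, hpow⟩ := exists_rpow_le_mul (r := fun b => 1 - a b) hβ0 hNβ hc₁
    (hc.mono fun b hb => hb.1)
  have ha1 : Tendsto a atTop (nhds 1) := by
    have h0 : Tendsto (fun b => 1 - a b) atTop (nhds 0) := by
      refine squeeze_zero' (Eventually.of_forall fun b => (sub_pos.2 (ha b).2).le)
        (hc.mono fun b hb => hb.2) ?_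
      simpa using (tendsto_rpow_neg_atTop hβ0).const_mul c₂
    simpa using (tendsto_const_nhds (x := (1 : ℝ))).sub h0
  simp only [hpb', hE]
  refine tendsto_secondMoment_div_sq hμ hFbar_pos hG
    (tendsto_zero_of_regularlyVarying hanti hFbar_pos hα (hrv 2 two_pos)) (by lia) fun ρ hρ => ?_
  obtain ⟨k, rfl⟩ : ∃ k, n = k + 1 := ⟨n - 1, by lia⟩
  filter_upwards [eventually_secondMoment_le hμ hFbar_pos hG hα hrv ha ha1 hlevel hθ hpow le_rfl hρ]
    with b hb
  simpa using hb b (by simp)
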